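/- Let V be a Jordan triple system, let w ∈ V be a maximal tripotent, and let u ∈ V be a tripotent with D(w,w)u = u/2. Set w_u = 2{u,u,w}. Then the Peirce space V_2(w_u) is contained in V_1(u): every x ∈ V with D(w_u,w_u)x = x satisfies D(u,u)x = x/2. -/

import Mathlib

/-- A Jordan triple system: a complex vector space with a triple product
symmetric and linear in the outer variables, conjugate-linear in the middle
variable, satisfying the Jordan triple (main) identity. -/
structure JordanTriple (V : Type*) [AddCommGroup V] [Module ℂ V] where
  tp : V → V → V → V
  symm_outer : ∀ a b c, tp a b c = tp c b a
  add_fst : ∀ a a' b c, tp (a + a') b c = tp a b c + tp a' b c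
  smul_fst : ∀ (r : ℂ) (a b c : V), tp (r • a) b c = r • tp a b c
  add_snd : ∀ a b b' c, tp a (b + b') c = tp a b c + tp a b' c
  smul_snd : ∀ (r : ℂ) (a b c : V), tp a (r • b) c = (starRingEnd ℂ r) • tp a b c
  jordan_identity : ∀ a b x y z,
    tp a b (tp x y z) = tp (tp a b x) y z - tp x (tp b a y) z + tp x y (tp a b z)

namespace JordanTriple

variable {V : Type*} [AddCommGroup V] [Module ℂ V]

/-- A tripotent: `{e,e,e} = e`. -/
def IsTripotent (T : JordanTriple V) (e : V) : Prop := T.tp e e e = e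

/-- Orthogonality of elements: `D(x,y) = 0` and `D(y,x) = 0`. -/
def Orthogonal (T : JordanTriple V) (x y : V) : Prop :=
  (∀ z, T.tp x y z = 0) ∧ (∀ z, T.tp y x z = 0)

/-- A maximal (complete) tripotent: the Peirce projection
`P₀(w) = I - 2 D(w,w) + Q(w)²` vanishes on `V`. -/
def IsMaximalTripotent (T : JordanTriple V) (w : V) : Prop :=
  T.IsTripotent w ∧ ∀ z : V, z - (2 : ℂ) • T.tp w w z + T.tp w (T.tp w z w) w = 0

/-- Orthogonality is symmetric: `D(a,a)b = 0` implies `D(b,b)a = 0`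
(true in every JB*-triple). -/
def OrthSymm (T : JordanTriple V) : Prop :=
  ∀ a b : V, T.tp a a b = 0 → T.tp b b a = 0

end JordanTriple

variable {V : Type*} [AddCommGroup V] [Module ℂ V]

open JordanTriple

namespace JordanTriple

section Algebra

variable (T : JordanTriple V)

lemma add_thd (a b c c' : V) : T.tp a b (c + c') = T.tp a b c + T.tp a b c' := by
  rw [T.symm_outer, T.add_fst, T.symm_outer c, T.symm_outer c']

lemma smul_thd (r : ℂ) (a b c : V) : T.tp a b (r • c) = r • T.tp a b c := by
  rw [T.symm_outer, T.smul_fst, T.symm_outer c]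

lemma zero_fst (b c : V) : T.tp 0 b c = 0 := by
  simpa using T.smul_fst 0 0 b c

lemma zero_snd (a c : V) : T.tp a 0 c = 0 := by
  simpa using T.smul_snd 0 a 0 c

lemma zero_thd (a b : V) : T.tp a b 0 = 0 := by
  simpa using T.smul_thd 0 a b 0

lemma sub_thd (a b c c' : V) : T.tp a b (c - c') = T.tp a b c - T.tp a b c' := by
  rw [sub_eq_add_neg, ← neg_one_smul ℂ c', T.add_thd, T.smul_thd]
  module

/-- Peirce arithmetic: triple products of eigenvectors of `D(e,e)` are eigenvectors. -/
lemma peirce_arith {e x y z : V} {α β γ : ℂ} (hx : T.tp e e x = α • x)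
    (hy : T.tp e e y = β • y) (hz : T.tp e e z = γ • z) :
    T.tp e e (T.tp x y z) = (α - starRingEnd ℂ β + γ) • T.tp x y z := by
  rw [T.jordan_identity, hx, hy, hz, T.smul_fst, T.smul_snd, T.smul_thd]
  module

/-- Peirce arithmetic for rational eigenvalues. -/
lemma peirce_arith_rat {e x y z : V} {α β γ : ℚ} (δ : ℚ) (hx : T.tp e e x = (α : ℂ) • x)
    (hy : T.tp e e y = (β : ℂ) • y) (hz : T.tp e e z = (γ : ℂ) • z)
    (hδ : α - β + γ = δ) :
    T.tp e e (T.tp x y z) = (δ : ℂ) • T.tp x y z := by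
  rw [T.peirce_arith hx hy hz, ← hδ, map_ratCast]
  push_cast
  rfl

variable {T} {e : V}

lemma IsTripotent.eq (he : T.IsTripotent e) : T.tp e e e = e := he

lemma IsTripotent.quad_aux (he : T.IsTripotent e) (x : V) :
    T.tp e e (T.tp e x e) = T.tp e x e ∧ T.tp e (T.tp e e x) e = T.tp e x e := by
  unfold IsTripotent at he
  have h1 := T.jordan_identity e e e x e
  have h2 := T.jordan_identity e x e e e
  rw [he] at h1 h2
  rw [T.symm_outer (T.tp e x e) e e, T.symm_outer x e e] at h2
  constructor
  · linear_combination (norm := module) (1 / 3 : ℂ) • h1 - (1 / 3 : ℂ) • h2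
  · linear_combination (norm := module) (2 / 3 : ℂ) • h1 + (1 / 3 : ℂ) • h2

lemma IsTripotent.quad_eigen (he : T.IsTripotent e) (x : V) :
    T.tp e e (T.tp e x e) = T.tp e x e := (he.quad_aux x).1

lemma IsTripotent.quad_left (he : T.IsTripotent e) (x : V) :
    T.tp e (T.tp e e x) e = T.tp e x e := (he.quad_aux x).2

/-- `Q(e)² = 2 D(e,e)² - D(e,e)`. -/
lemma IsTripotent.quad_quad (he : T.IsTripotent e) (x : V) :
    T.tp e (T.tp e x e) e = (2 : ℂ) • T.tp e e (T.tp e e x) - T.tp e e x := by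
  have h := T.jordan_identity x e e e e
  rw [he, T.symm_outer x e e, T.symm_outer (T.tp e e x) e e] at h
  linear_combination (norm := module) h

lemma IsTripotent.cubic (he : T.IsTripotent e) (x : V) :
    (2 : ℂ) • T.tp e e (T.tp e e (T.tp e e x)) - T.tp e e (T.tp e e x) =
      (2 : ℂ) • T.tp e e (T.tp e e x) - T.tp e e x := by
  have h := he.quad_eigen (T.tp e x e)
  rwa [he.quad_quad, T.sub_thd, T.smul_thd] at h

/-- `Q(e)² = id` on `V₂(e)`. -/
lemma IsTripotent.quad_quad_of_peirce_two (he : T.IsTripotent e) {x : V}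
    (hx : T.tp e e x = x) : T.tp e (T.tp e x e) e = x := by
  rw [he.quad_quad, hx, hx]
  module

lemma IsTripotent.quad_of_peirce_zero (he : T.IsTripotent e) {x : V}
    (hx : T.tp e e x = 0) : T.tp e x e = 0 := by
  rw [← he.quad_left, hx, T.zero_snd]

/-- `-1/2` is not an eigenvalue of `D(e,e)`. -/
lemma IsTripotent.eq_zero_of_neg_half (he : T.IsTripotent e) {x : V}
    (hx : T.tp e e x = (-1 / 2 : ℂ) • x) : x = 0 := by
  have h := he.cubic x
  simp only [hx, T.smul_thd] at h
  linear_combination (norm := module) (-2 / 3 : ℂ) • h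

lemma IsTripotent.tp_self_peirce_zero (he : T.IsTripotent e) {b : V}
    (hb : T.tp e e b = 0) (z : V) : T.tp e b z = 0 := by
  have h1 := T.jordan_identity e e e b z
  have h2 := T.jordan_identity e b e e z
  rw [he, hb, T.zero_snd] at h1
  rw [he.quad_of_peirce_zero hb, T.symm_outer b e e, hb, T.zero_snd, T.zero_fst] at h2
  linear_combination (norm := module) -h1 - h2

lemma IsTripotent.tp_peirce_zero_self (he : T.IsTripotent e) {b : V}
    (hb : T.tp e e b = 0) (z : V) : T.tp b e z = 0 := by
  have h1 := T.jordan_identity e e b e z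
  have h2 := T.jordan_identity b e e e z
  rw [he, hb, T.zero_fst] at h1
  rw [he.quad_of_peirce_zero hb, T.symm_outer b e e, hb, T.zero_snd, T.zero_fst] at h2
  linear_combination (norm := module) h1 + h2

/-- `{V₂(e), V₀(e), V} = 0`. -/
lemma IsTripotent.tp_peirce_two_zero (he : T.IsTripotent e) {a b : V}
    (ha : T.tp e e a = a) (hb : T.tp e e b = 0) (z : V) : T.tp a b z = 0 := by
  have h := T.jordan_identity e (T.tp e a e) e b z
  rw [he.quad_quad_of_peirce_two ha, T.symm_outer (T.tp e a e) e b,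
    he.tp_peirce_zero_self hb, he.tp_self_peirce_zero hb, he.tp_self_peirce_zero hb,
    T.zero_snd, T.zero_thd] at h
  linear_combination (norm := module) -h

/-- `{V₀(e), V₂(e), V} = 0`. -/
lemma IsTripotent.tp_peirce_zero_two (he : T.IsTripotent e) {a b : V}
    (ha : T.tp e e a = a) (hb : T.tp e e b = 0) (z : V) : T.tp b a z = 0 := by
  have h := T.jordan_identity (T.tp e a e) e b e z
  rw [he.quad_quad_of_peirce_two ha, T.symm_outer (T.tp e a e) e b,
    he.tp_peirce_zero_self hb, he.tp_peirce_zero_self hb, he.tp_peirce_zero_self hb,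
    T.zero_fst, T.zero_thd] at h
  linear_combination (norm := module) h

/-- A maximal tripotent has zero Peirce-zero space. -/
lemma IsMaximalTripotent.eq_zero {w : V} (hw : T.IsMaximalTripotent w) {x : V}
    (hx : T.tp w w x = 0) : x = 0 := by
  have h := hw.2 x
  rw [hx, hw.1.quad_of_peirce_zero hx, T.zero_snd] at h
  simpa using h

/-- If `u` is a tripotent and `p + q` a maximal tripotent with
`p ∈ V₁(u)` and `q ∈ V₀(u)`, where `p` is a tripotent with `u ∈ V₁(p)` and `{q,p,u} = 0`,
then `V₂(p) ⊆ V₁(u)`. -/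
lemma IsMaximalTripotent.peirce_two_subset_peirce_one {p q u : V}
    (hw : T.IsMaximalTripotent (p + q)) (hu : T.IsTripotent u) (hp : T.IsTripotent p)
    (hup : T.tp u u p = (1 / 2 : ℂ) • p) (huq : T.tp u u q = 0)
    (hpu : T.tp p p u = (1 / 2 : ℂ) • u) (hqpu : T.tp q p u = 0)
    {x : V} (hx : T.tp p p x = x) : T.tp u u x = (1 / 2 : ℂ) • x := by
  have two {y : V} (hy : T.tp u u y = y) (hpy : T.tp p p y = y) : y = 0 := by
    have hz := hu.quad_eigen y
    have hpz : T.tp p p (T.tp u y u) = 0 := by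
      have := T.peirce_arith_rat (e := p) (x := u) (y := y) (z := u)
        (α := 1 / 2) (β := 1) (γ := 1 / 2) 0
        (by push_cast; exact hpu) (by simpa using hpy) (by push_cast; exact hpu) (by norm_num)
      simpa using this
    have hqpz : T.tp q p (T.tp u y u) = 0 := by
      rw [T.jordan_identity, hqpu, T.symm_outer p q y, hu.tp_peirce_two_zero hy huq,
        T.zero_fst, T.zero_snd, T.zero_thd]
      simp
    have hwz : T.tp (p + q) (p + q) (T.tp u y u) = 0 := by
      rw [T.add_snd, T.add_fst, hpz, hqpz, T.symm_outer (p + q) q,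
        hu.tp_peirce_two_zero hz huq]
      simp
    rw [← hu.quad_quad_of_peirce_two hy, hw.eq_zero hwz, T.zero_snd]
  have zero {y : V} (hy : T.tp u u y = 0) (hpy : T.tp p p y = y) : y = 0 := by
    have hz : T.tp u u (T.tp p y p) = T.tp p y p := by
      have := T.peirce_arith_rat (e := u) (x := p) (y := y) (z := p)
        (α := 1 / 2) (β := 0) (γ := 1 / 2) 1
        (by push_cast; exact hup) (by simpa using hy) (by push_cast; exact hup) (by norm_num)
      simpa using this
    rw [← hp.quad_quad_of_peirce_two hpy, two hz (hp.quad_eigen y), T.zero_snd]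
  have comm {y : V} (hy : T.tp p p y = y) : T.tp p p (T.tp u u y) = T.tp u u y := by
    have := T.peirce_arith_rat (e := p) (x := u) (y := u) (z := y)
      (α := 1 / 2) (β := 1 / 2) (γ := 1) 1
      (by push_cast; exact hpu) (by push_cast; exact hpu) (by simpa using hy) (by norm_num)
    simpa using this
  have cub := hu.cubic x
  have h2 : (2 : ℂ) • T.tp u u (T.tp u u x) - T.tp u u x = 0 := by
    apply two
    · rw [T.sub_thd, T.smul_thd, cub]
    · rw [T.sub_thd, T.smul_thd, comm (comm hx), comm hx]
  have h0 : x - (3 : ℂ) • T.tp u u x + (2 : ℂ) • T.tp u u (T.tp u u x) = 0 := by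
    apply zero
    · rw [T.add_thd, T.sub_thd, T.smul_thd, T.smul_thd]
      linear_combination (norm := module) cub
    · rw [T.add_thd, T.sub_thd, T.smul_thd, T.smul_thd, comm (comm hx), comm hx, hx]
  linear_combination (norm := module) (1 / 2 : ℂ) • h2 - (1 / 2 : ℂ) • h0

end Algebra

end JordanTriple

/-- If `w` is a maximal tripotent and `u` is a tripotent with `D(w,w)u = u/2`,
then with `w_u = 2{u,u,w}` one has `V₂(w_u) ⊆ V₁(u)`. -/
theorem peirce_two_wu_subset_peirce_one_u (T : JordanTriple V) (w u : V)
    (hw : T.IsMaximalTripotent w) (hu : T.IsTripotent u)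
    (h1 : T.tp w w u = (1/2 : ℂ) • u)
    (wu : V) (hwu : wu = (2 : ℂ) • T.tp u u w) :
    ∀ x : V, T.tp wu wu x = x → T.tp u u x = (1/2 : ℂ) • x := by
  obtain ⟨hwt, -⟩ := id hw
  -- `w` has no component in `V₂(u)`
  have huwu : T.tp u w u = 0 := by
    apply hw.eq_zero
    have := T.peirce_arith_rat (e := w) (x := u) (y := w) (z := u)
      (α := 1 / 2) (β := 1) (γ := 1 / 2) 0
      (by push_cast; exact h1) (by simpa using hwt.eq) (by push_cast; exact h1) (by norm_num)
    simpa using this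
  have hD : (2 : ℂ) • T.tp u u (T.tp u u w) - T.tp u u w = 0 := by
    rw [← hu.quad_quad, huwu, T.zero_snd]
  obtain ⟨q, hq⟩ : ∃ q, q = w - wu := ⟨_, rfl⟩
  have hw_eq : w = wu + q := by rw [hq]; abel
  have hup : T.tp u u wu = (1 / 2 : ℂ) • wu := by
    rw [hwu, T.smul_thd]
    linear_combination (norm := module) hD
  have huq : T.tp u u q = 0 := by
    rw [hq, T.sub_thd, hup, hwu]
    module
  have hwp : T.tp w w wu = wu := by
    have := T.peirce_arith_rat (e := w) (x := u) (y := u) (z := w)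
      (α := 1 / 2) (β := 1 / 2) (γ := 1) 1
      (by push_cast; exact h1) (by push_cast; exact h1) (by simpa using hwt.eq) (by norm_num)
    rw [hwu, T.smul_thd, this]
    simp
  have hwq : T.tp w w q = q := by
    rw [hq, T.sub_thd, hwp]
    exact congrArg (· - wu) hwt
  have hup' : T.tp u u wu = ((1 / 2 : ℚ) : ℂ) • wu := by push_cast; exact hup
  have huq' : T.tp u u q = ((0 : ℚ) : ℂ) • q := by simpa using huq
  have huu' : T.tp u u u = ((1 : ℚ) : ℂ) • u := by simpa using hu.eq
  have expand (z : V) : T.tp w w z =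
      T.tp wu wu z + T.tp q wu z + T.tp wu q z + T.tp q q z := by
    rw [hw_eq, T.add_snd, T.add_fst, T.add_fst]
    abel
  -- components of `{w,w,u} = u/2` in the Peirce spaces of `u`
  have hsum : T.tp wu wu u + T.tp q wu u = (1 / 2 : ℂ) • u := by
    rw [← h1, expand, T.symm_outer wu q, T.symm_outer q q, hu.tp_self_peirce_zero huq,
      hu.tp_self_peirce_zero huq]
    abel
  have e1 := T.peirce_arith_rat 1 hup' hup' huu' (by norm_num)
  have e2 := T.peirce_arith_rat (1 / 2) huq' hup' huu' (by norm_num)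
  have hsum' := congrArg (T.tp u u) hsum
  rw [T.add_thd, T.smul_thd, e1, e2, hu] at hsum'
  push_cast at hsum'
  have hqpu : T.tp q wu u = 0 := by
    linear_combination (norm := module) (2 : ℂ) • hsum - (2 : ℂ) • hsum'
  have hpu : T.tp wu wu u = (1 / 2 : ℂ) • u := by rw [← hsum, hqpu, add_zero]
  have hqpp : T.tp q wu wu = 0 := by
    have h := T.jordan_identity wu u q wu u
    have e3 := T.peirce_arith_rat 1 huu' hup' hup' (by norm_num)
    rw [hqpu, T.zero_thd, T.symm_outer wu u q, hu.tp_peirce_zero_self huq, T.zero_fst,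
      hu.tp_peirce_zero_two (by simpa using e3) huq, T.symm_outer wu u u, hup,
      T.smul_thd] at h
    linear_combination (norm := module) (-2 : ℂ) • h
  have hqpq : T.tp q wu q = 0 := by
    apply hu.eq_zero_of_neg_half
    have := T.peirce_arith_rat (-1 / 2) huq' hup' huq' (by norm_num)
    rw [this]
    push_cast
    rfl
  -- components of `{w,w,q} = q` and `{w,w,wu} = wu`
  have hpqq : T.tp wu q q = 0 := by
    have h := expand q
    rw [hwq, T.symm_outer wu wu q, hqpp, hqpq] at h
    have h' := congrArg (T.tp u u) h
    simp only [T.add_thd, T.zero_thd] at h'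
    rw [huq, T.peirce_arith_rat (1 / 2) hup' huq' huq' (by norm_num),
      T.peirce_arith_rat 0 huq' huq' huq' (by norm_num)] at h'
    push_cast at h'
    linear_combination (norm := module) (-2 : ℂ) • h'
  have hp : T.IsTripotent wu := by
    have h := expand wu
    rw [hwp, hqpp, T.symm_outer q q wu, hpqq] at h
    have h' := congrArg (T.tp u u) h
    simp only [T.add_thd, T.zero_thd] at h'
    rw [hup, T.peirce_arith_rat (1 / 2) hup' hup' hup' (by norm_num),
      T.peirce_arith_rat 1 hup' huq' hup' (by norm_num)] at h'
    push_cast at h'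
    unfold IsTripotent
    linear_combination (norm := module) (2 : ℂ) • h' - (2 : ℂ) • h
  intro x hx
  rw [hw_eq] at hw
  exact hw.peirce_two_subset_peirce_one hu hp hup huq hpu hqpu hx
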